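/- The complexified complement M(A) is the total space of a principal bundle over the space Z(A) with structure group V*, the linear dual of V. In particular, M(A) is weakly homotopy equivalent to Z(A). -/

import Mathlib

open scoped Topology.Homotopy

/-- The map induced on path components by a continuous map. -/
def pi0Map {X Y : Type*} [TopologicalSpace X] [TopologicalSpace Y] (g : C(X, Y)) :
    ZerothHomotopy X → ZerothHomotopy Y :=
  Quotient.map g (fun _ _ h => h.elim fun p => ⟨p.map g.continuous⟩)

/-- The map induced on homotopy groups by a continuous map. -/
def piMap {X Y : Type*} [TopologicalSpace X] [TopologicalSpace Y] (n : ℕ) (g : C(X, Y)) (x : X) :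
    HomotopyGroup (Fin n) X x → HomotopyGroup (Fin n) Y (g x) :=
  Quotient.map (fun p => ⟨g.comp p.1, fun y hy => by
      simp only [ContinuousMap.comp_apply, p.2 y hy]⟩)
    (fun p q h => h.elim fun H => ⟨H.compContinuousMap g⟩)

/-- A weak homotopy equivalence: a continuous map inducing a bijection on path components
and isomorphisms on all homotopy groups at every basepoint. -/
def IsWeakHomotopyEquiv {X Y : Type*} [TopologicalSpace X] [TopologicalSpace Y]
    (g : C(X, Y)) : Prop :=
  Function.Bijective (pi0Map g) ∧
    ∀ (n : ℕ) (x : X), Function.Bijective (piMap n g x)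

/-- Composition of sign vectors: `(X ∘ Y) e = X e` if `X e ≠ 0`, and `Y e` otherwise. -/
def scomp {E : Type*} (X Y : E → SignType) : E → SignType :=
  fun e => if X e = 0 then Y e else X e

/-- The partial order on sign vectors: `X ≤ Y` iff `X ∘ Y = Y`. -/
def sle {E : Type*} (X Y : E → SignType) : Prop := scomp X Y = Y

theorem sle_refl {E : Type*} (X : E → SignType) : sle X X := by
  funext e; show (if X e = 0 then X e else X e) = X e; split <;> rfl

theorem sle_trans {E : Type*} {X Y Z : E → SignType} (h₁ : sle X Y) (h₂ : sle Y Z) :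
    sle X Z := by
  funext e
  have h1 := congrFun h₁ e
  have h2 := congrFun h₂ e
  revert h1 h2
  show (if X e = 0 then Y e else X e) = Y e → (if Y e = 0 then Z e else Y e) = Z e →
    (if X e = 0 then Z e else X e) = Z e
  generalize X e = a; generalize Y e = b; generalize Z e = c
  revert a b c; decide

theorem sle_antisymm {E : Type*} {X Y : E → SignType} (h₁ : sle X Y) (h₂ : sle Y X) :
    X = Y := by
  funext e
  have h1 := congrFun h₁ e
  have h2 := congrFun h₂ e
  revert h1 h2
  show (if X e = 0 then Y e else X e) = Y e → (if Y e = 0 then X e else Y e) = X e → X e = Y e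
  generalize X e = a; generalize Y e = b
  revert a b; decide

/-- The separating set of two sign vectors: the indices where they take opposite
nonzero signs. -/
def SepSet {E : Type*} (X Y : E → SignType) : Set E :=
  {e | (X e = 1 ∧ Y e = -1) ∨ (X e = -1 ∧ Y e = 1)}

section Geometry

variable {E : Type*} {V : Type*} [NormedAddCommGroup V] [NormedSpace ℝ V]

/-- The face of a sign vector `X`, relative to the family of cooriented affine hyperplanes
`H_e = {v | f e v = 0}`, with positive side `H_e⁺ = {v | f e v > 0}` and negative side
`H_e⁻ = {v | f e v < 0}`. -/
def face (f : E → (V →ᵃ[ℝ] ℝ)) (X : E → SignType) : Set V :=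
  {v | ∀ e, SignType.sign (f e v) = X e}

/-- The conditional oriented matroid `L(A,K)`: the set of sign vectors whose face
meets `K`. -/
def covs (f : E → (V →ᵃ[ℝ] ℝ)) (K : Set V) : Set (E → SignType) :=
  {X | (face f X ∩ K).Nonempty}

/-- A tope of `L(A,K)`: a maximal covector. -/
def IsTope (f : E → (V →ᵃ[ℝ] ℝ)) (K : Set V) (T : E → SignType) : Prop :=
  T ∈ covs f K ∧ ∀ Y ∈ covs f K, sle T Y → Y = T

/-- The set of topes of `L(A,K)`, as a type carrying the discrete topology. -/
def Topes (f : E → (V →ᵃ[ℝ] ℝ)) (K : Set V) : Type _ := {T : E → SignType // IsTope f K T}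

instance (f : E → (V →ᵃ[ℝ] ℝ)) (K : Set V) : TopologicalSpace (Topes f K) := ⊥

instance (f : E → (V →ᵃ[ℝ] ℝ)) (K : Set V) : DiscreteTopology (Topes f K) := ⟨rfl⟩

/-- Points of `K × T(A,K)`. -/
abbrev ZPre (f : E → (V →ᵃ[ℝ] ℝ)) (K : Set V) : Type _ := K × Topes f K

/-- The gluing relation defining `Z(A,K)`: `(v,T) ∼ (v',T')` iff `v = v'` and `v` lies on
no hyperplane separating `T` from `T'`. -/
def ZRel (f : E → (V →ᵃ[ℝ] ℝ)) (K : Set V) : ZPre f K → ZPre f K → Prop :=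
  fun p q => (p.1 : V) = (q.1 : V) ∧ ∀ e ∈ SepSet p.2.1 q.2.1, f e (p.1 : V) ≠ 0

/-- The space `Z(A,K)`: one copy of `K` for each tope, glued along the complement of the
separating hyperplanes, with the quotient topology. -/
def ZSpace (f : E → (V →ᵃ[ℝ] ℝ)) (K : Set V) : Type _ := Quot (ZRel f K)

instance (f : E → (V →ᵃ[ℝ] ℝ)) (K : Set V) : TopologicalSpace (ZSpace f K) :=
  inferInstanceAs (TopologicalSpace (Quot (ZRel f K)))

/-- The projection `π : Z(A,K) → V` (with image `K`), sending `[(v,T)]` to `v`. -/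
def Zproj (f : E → (V →ᵃ[ℝ] ℝ)) (K : Set V) : ZSpace f K → V :=
  Quot.lift (fun p => (p.1 : V)) (fun _ _ h => h.1)

/-- The set `K_{X,T} = K ∩ ⋂_{e : X_e = 0} H_e^{T_e}`. -/
def KXT (f : E → (V →ᵃ[ℝ] ℝ)) (K : Set V) (X T : E → SignType) : Set V :=
  K ∩ ⋂ e ∈ {e | X e = 0}, {v | SignType.sign (f e v) = T e}

/-- The subset `U_{X,T} ⊆ Z(A,K)`: the image of `K_{X,T} × {T}` under the quotient map. -/
def UXT (f : E → (V →ᵃ[ℝ] ℝ)) (K : Set V) (X : E → SignType) (T : Topes f K) :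
    Set (ZSpace f K) :=
  {z | ∃ (v : V) (hv : v ∈ K), v ∈ KXT f K X T.1 ∧ z = Quot.mk (ZRel f K) (⟨v, hv⟩, T)}

/-- The complexified complement `M(A,K)`, where `V ⊗ ℂ` is modeled as `V × V` (real and
imaginary parts): `v + iw` lies on `H_e ⊗ ℂ` iff `f e v = 0` and the linear part of `f e`
vanishes on `w`. -/
def MSpace (f : E → (V →ᵃ[ℝ] ℝ)) (K : Set V) : Type _ :=
  {p : V × V // p.1 ∈ K ∧ ∀ e, ¬(f e p.1 = 0 ∧ (f e).linear p.2 = 0)}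

instance (f : E → (V →ᵃ[ℝ] ℝ)) (K : Set V) : TopologicalSpace (MSpace f K) :=
  inferInstanceAs (TopologicalSpace {p : V × V // p.1 ∈ K ∧ _})

/-- The projection `ρ : M(A,K) → V` (with image `K`), sending `v + iw` to `v`. -/
def Mproj (f : E → (V →ᵃ[ℝ] ℝ)) (K : Set V) : MSpace f K → V := fun p => p.1.1

end Geometry

/-- `φ : P → B` is a principal bundle for the (additive) topological group `G`, acting on
`P` via `act`: the action is continuous and fiber-preserving, and `φ` is locally trivial
with `G`-equivariant trivializations. -/
structure IsAddPrincipalBundle (G : Type*) [AddGroup G] [TopologicalSpace G]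
    {P B : Type*} [TopologicalSpace P] [TopologicalSpace B]
    (act : G → P → P) (φ : P → B) : Prop where
  act_zero : ∀ p, act 0 p = p
  act_add : ∀ g g' p, act (g + g') p = act g (act g' p)
  continuous_act : Continuous fun q : G × P => act q.1 q.2
  continuous_proj : Continuous φ
  proj_act : ∀ g p, φ (act g p) = φ p
  locTriv : ∀ b : B, ∃ U : Set B, IsOpen U ∧ b ∈ U ∧ ∃ h : (φ ⁻¹' U) ≃ₜ U × G,
    (∀ p : φ ⁻¹' U, ((h p).1 : B) = φ p.1) ∧
    ∀ (g : G) (p : φ ⁻¹' U) (hq : act g p.1 ∈ φ ⁻¹' U),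
      h ⟨act g p.1, hq⟩ = ((h p).1, g + (h p).2)

variable {V : Type*} [NormedAddCommGroup V] [NormedSpace ℝ V] [FiniteDimensional ℝ V]
variable {E : Type*} [Fintype E]

/-- The logarithmic barrier `s ↦ log (s + √(s² + t²))`, with degeneration parameter `t`. -/
noncomputable def logBarrier (t s : ℝ) : ℝ := Real.log (s + √(s ^ 2 + t ^ 2))

theorem add_sqrt_pos {t s : ℝ} (h : t = 0 → 0 < s) : 0 < s + √(s ^ 2 + t ^ 2) := by
  by_cases ht : t = 0
  · have := h ht
    positivity
  · have h1 : |s| < √(s ^ 2 + t ^ 2) := by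
      rw [← Real.sqrt_sq_eq_abs]
      exact Real.sqrt_lt_sqrt (sq_nonneg s) (by have := sq_pos_of_ne_zero ht; linarith)
    have := neg_abs_le s
    linarith

theorem add_sqrt_mono (t : ℝ) : Monotone fun s : ℝ => s + √(s ^ 2 + t ^ 2) := by
  intro s s' h
  have h1 : 0 ≤ √(s ^ 2 + t ^ 2) := Real.sqrt_nonneg _
  have h2 : 0 ≤ √(s' ^ 2 + t ^ 2) := Real.sqrt_nonneg _
  have e1 : √(s ^ 2 + t ^ 2) ^ 2 = s ^ 2 + t ^ 2 := Real.sq_sqrt (by positivity)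
  have e2 : √(s' ^ 2 + t ^ 2) ^ 2 = s' ^ 2 + t ^ 2 := Real.sq_sqrt (by positivity)
  have b1 : |s| ≤ √(s ^ 2 + t ^ 2) := Real.abs_le_sqrt (by nlinarith [sq_nonneg t])
  have b2 : |s'| ≤ √(s' ^ 2 + t ^ 2) := Real.abs_le_sqrt (by nlinarith [sq_nonneg t])
  have c1 := neg_abs_le s
  have c2 := neg_abs_le s'
  show s + √(s ^ 2 + t ^ 2) ≤ s' + √(s' ^ 2 + t ^ 2)
  by_contra! hlt
  have hp : 0 < √(s ^ 2 + t ^ 2) + √(s' ^ 2 + t ^ 2) := by linarith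
  nlinarith

theorem logBarrier_mul_nonneg {t s s' : ℝ} (h : t = 0 → 0 < s) (h' : t = 0 → 0 < s') :
    0 ≤ (logBarrier t s - logBarrier t s') * (s - s') := by
  rcases le_total s s' with hs | hs
  · have := Real.log_le_log (add_sqrt_pos h) (add_sqrt_mono t hs)
    exact mul_nonneg_of_nonpos_of_nonpos (sub_nonpos.2 this) (sub_nonpos.2 hs)
  · have := Real.log_le_log (add_sqrt_pos h') (add_sqrt_mono t hs)
    exact mul_nonneg (sub_nonneg.2 this) (sub_nonneg.2 hs)

theorem logBarrier_add_neg {t : ℝ} (ht : t ≠ 0) (s : ℝ) :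
    logBarrier t s + logBarrier t (-s) = Real.log (t ^ 2) := by
  have h1 := add_sqrt_pos (t := t) (s := s) (fun h => absurd h ht)
  have h2 := add_sqrt_pos (t := t) (s := -s) (fun h => absurd h ht)
  rw [logBarrier, logBarrier, ← Real.log_mul h1.ne' h2.ne']
  congr 1
  have e1 : √(s ^ 2 + t ^ 2) ^ 2 = s ^ 2 + t ^ 2 := Real.sq_sqrt (by positivity)
  rw [neg_sq]
  linear_combination e1

theorem hasStrictDerivAt_logBarrier {t s : ℝ} (h : t = 0 → 0 < s) :
    HasStrictDerivAt (logBarrier t) (√(s ^ 2 + t ^ 2))⁻¹ s := by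
  have hpos := add_sqrt_pos h
  have hne : s ^ 2 + t ^ 2 ≠ 0 := by
    by_cases ht : t = 0
    · have := h ht
      positivity
    · positivity
  have hsq : √(s ^ 2 + t ^ 2) ≠ 0 := by
    rw [Real.sqrt_ne_zero']
    positivity
  have h1 : HasStrictDerivAt (fun s : ℝ => s ^ 2 + t ^ 2) (2 * s) s := by
    simpa using (hasStrictDerivAt_pow 2 s).add_const (t ^ 2)
  have h2 := ((hasStrictDerivAt_id s).add (h1.sqrt hne)).log hpos.ne'
  convert! h2 using 1
  simp only [id, Pi.add_apply]
  field_simp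
  ring

theorem continuousAt_logBarrier {X : Type*} [TopologicalSpace X] {t s : X → ℝ} {x : X}
    (ht : ContinuousAt t x) (hs : ContinuousAt s x) (h : t x = 0 → 0 < s x) :
    ContinuousAt (fun y => logBarrier (t y) (s y)) x :=
  ContinuousAt.log (by fun_prop) (add_sqrt_pos h).ne'

theorem tendsto_logBarrier_zero :
    Filter.Tendsto (logBarrier 0) (nhdsWithin 0 (Set.Ioi 0)) Filter.atBot := by
  refine Real.tendsto_log_nhdsGT_zero.comp (tendsto_nhdsWithin_iff.2 ⟨?_, ?_⟩)
  · have : Continuous fun s : ℝ => s + √(s ^ 2 + 0 ^ 2) := by fun_prop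
    have h := this.tendsto 0
    simp only [ne_eq, OfNat.ofNat_ne_zero, not_false_eq_true, zero_pow, add_zero,
      Real.sqrt_zero] at h
    simpa using h.mono_left nhdsWithin_le_nhds
  · filter_upwards [self_mem_nhdsWithin] with s hs
    exact add_sqrt_pos fun _ => hs

/-- A Euclidean inner product on `V`, viewed as a map from `V` to its dual. -/
noncomputable def euclideanForm (V : Type*) [NormedAddCommGroup V] [NormedSpace ℝ V]
    [FiniteDimensional ℝ V] : V →L[ℝ] V →L[ℝ] ℝ :=
  (innerSL ℝ).bilinearComp (toEuclidean : V ≃L[ℝ] _).toContinuousLinearMap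
    (toEuclidean : V ≃L[ℝ] _).toContinuousLinearMap

theorem exists_euclideanForm_ge (V : Type*) [NormedAddCommGroup V] [NormedSpace ℝ V]
    [FiniteDimensional ℝ V] :
    ∃ c : ℝ, 0 < c ∧ ∀ u : V, c * ‖u‖ ^ 2 ≤ euclideanForm V u u := by
  obtain ⟨c, hc, h⟩ :=
    (toEuclidean : V ≃L[ℝ] _).toContinuousLinearMap.exists_antilipschitzWith
      (LinearMap.ker_eq_bot.2 toEuclidean.injective)
  refine ⟨((c : ℝ) ^ 2)⁻¹, by positivity, fun u => ?_⟩
  have h1 : ‖u‖ ≤ c * ‖toEuclidean u‖ := by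
    simpa using h.le_mul_norm_sub u 0
  have h2 : euclideanForm V u u = ‖toEuclidean u‖ ^ 2 := by
    simp [euclideanForm]
  rw [h2, inv_mul_le_iff₀ (by positivity), ← mul_pow]
  gcongr

/-- The gradient of the barrier function attached to the linear forms `b e` with degeneration
parameters `t e`. -/
noncomputable def barrierGrad (b : E → V →L[ℝ] ℝ) (t : E → ℝ) (w : V) : V →L[ℝ] ℝ :=
  euclideanForm V w + ∑ e, logBarrier (t e) (b e w) • b e

/-- The open cone cut out by the forms `b e` whose parameter `t e` vanishes. -/
def barrierCone (b : E → V →L[ℝ] ℝ) (t : E → ℝ) : Set V := {w | ∀ e, t e = 0 → 0 < b e w}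

theorem barrierGrad_apply (b : E → V →L[ℝ] ℝ) (t : E → ℝ) (w u : V) :
    barrierGrad b t w u = euclideanForm V w u + ∑ e, logBarrier (t e) (b e w) * b e u := by
  simp [barrierGrad]

theorem exists_norm_sub_le_barrierGrad (V : Type*) [NormedAddCommGroup V] [NormedSpace ℝ V]
    [FiniteDimensional ℝ V] (E : Type*) [Fintype E] :
    ∃ C : ℝ, 0 < C ∧ ∀ (b : E → V →L[ℝ] ℝ) (t : E → ℝ), ∀ w ∈ barrierCone b t,
      ∀ w' ∈ barrierCone b t, ‖w - w'‖ ≤ C * ‖barrierGrad b t w - barrierGrad b t w'‖ := by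
  obtain ⟨c, hc, h⟩ := exists_euclideanForm_ge V
  refine ⟨c⁻¹, by positivity, fun b t w hw w' hw' => ?_⟩
  have h1 : c * ‖w - w'‖ ^ 2 ≤ (barrierGrad b t w - barrierGrad b t w') (w - w') := by
    rw [sub_apply, barrierGrad_apply, barrierGrad_apply]
    have h2 : 0 ≤ ∑ e, (logBarrier (t e) (b e w) - logBarrier (t e) (b e w')) * b e (w - w') :=
      Finset.sum_nonneg fun e _ => by
        rw [map_sub]
        exact logBarrier_mul_nonneg (hw e) (hw' e)
    have h3 := h (w - w')
    simp only [sub_mul, Finset.sum_sub_distrib] at h2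
    rw [map_sub (euclideanForm V), sub_apply] at h3
    linarith
  have h2 : c * ‖w - w'‖ ^ 2 ≤ ‖barrierGrad b t w - barrierGrad b t w'‖ * ‖w - w'‖ :=
    h1.trans ((Real.le_norm_self _).trans (ContinuousLinearMap.le_opNorm _ _))
  rw [le_inv_mul_iff₀ hc]
  rcases (norm_nonneg (w - w')).eq_or_lt with h0 | h0
  · rw [← h0, mul_zero]
    positivity
  · nlinarith

omit [FiniteDimensional ℝ V] in
theorem isOpen_barrierCone (b : E → V →L[ℝ] ℝ) (t : E → ℝ) : IsOpen (barrierCone b t) := by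
  simp only [barrierCone, Set.ofPred_forall]
  exact isOpen_iInter_of_finite fun e => isOpen_iInter_of_finite fun _ =>
    isOpen_lt continuous_const (b e).continuous

theorem map_nhds_barrierGrad (b : E → V →L[ℝ] ℝ) (t : E → ℝ) {w : V}
    (hw : w ∈ barrierCone b t) :
    Filter.map (barrierGrad b t) (nhds w) = nhds (barrierGrad b t w) := by
  obtain ⟨c, hc, h⟩ := exists_euclideanForm_ge V
  have hd : HasStrictFDerivAt (barrierGrad b t)
      (euclideanForm V +
        ∑ e, ((√((b e w) ^ 2 + t e ^ 2))⁻¹ • b e).smulRight (b e)) w := by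
    refine (euclideanForm V).hasStrictFDerivAt.add (HasStrictFDerivAt.fun_sum fun e _ => ?_)
    exact ((hasStrictDerivAt_logBarrier (hw e)).comp_hasStrictFDerivAt w
      (b e).hasStrictFDerivAt).smul_const (b e)
  have : CompleteSpace V := FiniteDimensional.complete ℝ V
  refine hd.map_nhds_eq_of_surj ?_
  rw [LinearMap.range_eq_top]
  refine (LinearMap.injective_iff_surjective_of_finrank_eq_finrank ?_).1 ?_
  · rw [← (LinearMap.toContinuousLinearMap (𝕜 := ℝ) (E := V) (F' := ℝ)).finrank_eq]
    exact Subspace.dual_finrank_eq.symm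
  · rw [← LinearMap.ker_eq_bot, LinearMap.ker_eq_bot']
    intro u hu
    have h1 : ((euclideanForm V +
        ∑ e, ((√((b e w) ^ 2 + t e ^ 2))⁻¹ • b e).smulRight (b e)) u) u = 0 := by
      have := congrArg (fun l : V →L[ℝ] ℝ => l u) hu
      simpa using this
    simp only [add_apply, sum_apply, ContinuousLinearMap.smulRight_apply, smul_apply,
      smul_eq_mul] at h1
    have h2 : 0 ≤ ∑ e, (√((b e w) ^ 2 + t e ^ 2))⁻¹ * b e u * b e u :=
      Finset.sum_nonneg fun e _ => by
        rw [mul_assoc]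
        exact mul_nonneg (by positivity) (mul_self_nonneg _)
    have h3 := h u
    have h4 : ‖u‖ ^ 2 ≤ 0 := by
      by_contra! h5
      nlinarith [mul_pos hc h5]
    simpa using le_antisymm h4 (sq_nonneg _)

theorem isClosed_barrierGrad_image (b : E → V →L[ℝ] ℝ) (t : E → ℝ)
    (hne : (barrierCone b t).Nonempty) : IsClosed (barrierGrad b t '' barrierCone b t) := by
  obtain ⟨C, hC, h⟩ := exists_norm_sub_le_barrierGrad V E
  obtain ⟨w₁, hw₁⟩ := hne
  have : CompleteSpace V := FiniteDimensional.complete ℝ V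
  refine IsSeqClosed.isClosed fun ξs ξ hmem hlim => ?_
  replace hlim : Filter.Tendsto ξs Filter.atTop (nhds ξ) := hlim
  choose ws hws hξs using hmem
  have hcauchy : CauchySeq ws := by
    have := hlim.cauchySeq
    rw [Metric.cauchySeq_iff'] at this ⊢
    intro ε hε
    obtain ⟨N, hN⟩ := this (ε / C) (by positivity)
    refine ⟨N, fun n hn => ?_⟩
    have h1 := h b t _ (hws n) _ (hws N)
    have h2 := hN n hn
    rw [dist_eq_norm, ← hξs, ← hξs, lt_div_iff₀' hC] at h2
    rw [dist_eq_norm]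
    exact h1.trans_lt h2
  obtain ⟨w, hw⟩ := cauchySeq_tendsto_of_complete hcauchy
  have hbw (e : E) : Filter.Tendsto (fun n => b e (ws n)) Filter.atTop (nhds (b e w)) :=
    ((b e).continuous.tendsto w).comp hw
  have hbw' (e : E) : Filter.Tendsto (fun n => b e (w₁ - ws n)) Filter.atTop
      (nhds (b e (w₁ - w))) :=
    ((b e).continuous.tendsto _).comp (hw.const_sub w₁)
  have hcone : w ∈ barrierCone b t := by
    by_contra hnot
    obtain ⟨e₀, ht₀, hb₀⟩ : ∃ e, t e = 0 ∧ b e w ≤ 0 := by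
      simpa [barrierCone] using hnot
    have hb0 : b e₀ w = 0 :=
      le_antisymm hb₀ (ge_of_tendsto' (hbw e₀) fun n => (hws n e₀ ht₀).le)
    classical
    let lower (n : ℕ) : ℝ := ξs n (w₁ - ws n) - euclideanForm V (ws n) (w₁ - ws n) -
      ∑ e ∈ Finset.univ.erase e₀, logBarrier (t e) (b e w₁) * b e (w₁ - ws n)
    have hlower : Filter.Tendsto lower Filter.atTop (nhds (ξ (w₁ - w) -
        euclideanForm V w (w₁ - w) -
        ∑ e ∈ Finset.univ.erase e₀, logBarrier (t e) (b e w₁) * b e (w₁ - w))) := by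
      have happly : Continuous fun p : (V →L[ℝ] ℝ) × V => p.1 p.2 :=
        isBoundedBilinearMap_apply.continuous
      exact (((happly.tendsto _).comp (hlim.prodMk_nhds (hw.const_sub w₁))).sub
        ((happly.tendsto _).comp ((((euclideanForm V).continuous.tendsto w).comp hw).prodMk_nhds
          (hw.const_sub w₁)))).sub (tendsto_finsetSum _ fun e _ => (hbw' e).const_mul _)
    have hle (n : ℕ) : lower n ≤ logBarrier 0 (b e₀ (ws n)) * b e₀ (w₁ - ws n) := by
      have h1 : ∑ e ∈ Finset.univ.erase e₀, logBarrier (t e) (b e (ws n)) * b e (w₁ - ws n) ≤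
          ∑ e ∈ Finset.univ.erase e₀, logBarrier (t e) (b e w₁) * b e (w₁ - ws n) := by
        refine Finset.sum_le_sum fun e _ => ?_
        have := logBarrier_mul_nonneg (hw₁ e) (hws n e)
        rw [map_sub]
        linarith
      have h2 := barrierGrad_apply b t (ws n) (w₁ - ws n)
      rw [← Finset.add_sum_erase _ _ (Finset.mem_univ e₀), hξs, ht₀] at h2
      simp only [lower]
      linarith
    have hbot : Filter.Tendsto (fun n => logBarrier 0 (b e₀ (ws n)) * b e₀ (w₁ - ws n))
        Filter.atTop Filter.atBot := by
      refine Filter.Tendsto.atBot_mul_pos (C := b e₀ (w₁ - w)) ?_ ?_ (hbw' e₀)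
      · rw [map_sub, hb0, sub_zero]
        exact hw₁ e₀ ht₀
      · refine tendsto_logBarrier_zero.comp (tendsto_nhdsWithin_iff.2 ⟨?_, ?_⟩)
        · rw [← hb0]
          exact hbw e₀
        · exact Filter.Eventually.of_forall fun n => hws n e₀ ht₀
    exact not_tendsto_nhds_of_tendsto_atBot (Filter.tendsto_atBot_mono hle hbot) _ hlower
  refine ⟨w, hcone, ?_⟩
  have hcont : Filter.Tendsto (barrierGrad b t) (nhds w) (nhds (barrierGrad b t w)) :=
    (map_nhds_barrierGrad b t hcone).le
  refine tendsto_nhds_unique ?_ hlim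
  simpa only [Function.comp_def, hξs] using hcont.comp hw

theorem surjOn_barrierGrad (b : E → V →L[ℝ] ℝ) (t : E → ℝ)
    (hne : (barrierCone b t).Nonempty) :
    Set.SurjOn (barrierGrad b t) (barrierCone b t) Set.univ := by
  have hopen : IsOpen (barrierGrad b t '' barrierCone b t) := by
    rw [isOpen_iff_mem_nhds]
    rintro _ ⟨w, hw, rfl⟩
    rw [← map_nhds_barrierGrad b t hw]
    exact Filter.image_mem_map ((isOpen_barrierCone b t).mem_nhds hw)
  have := IsClopen.eq_univ ⟨isClosed_barrierGrad_image b t hne, hopen⟩ (hne.image _)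
  exact this.ge

theorem isTope_of_forall_ne_zero {E V : Type*} [NormedAddCommGroup V] [NormedSpace ℝ V]
    {f : E → (V →ᵃ[ℝ] ℝ)} {K : Set V} {T : E → SignType} (hT : T ∈ covs f K)
    (h : ∀ e, T e ≠ 0) : IsTope f K T := by
  refine ⟨hT, fun Y _ hY => ?_⟩
  funext e
  have := congrFun hY e
  simpa [scomp, h e, eq_comm] using this

/-- Moving slightly from `v` in the direction `w` lands in a tope, provided that `w` is
transverse to all hyperplanes through `v`. -/
theorem exists_isTope_of_transverse {E V : Type*} [Finite E] [NormedAddCommGroup V]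
    [NormedSpace ℝ V] (f : E → (V →ᵃ[ℝ] ℝ)) {v w : V}
    (h : ∀ e, f e v = 0 → (f e).linear w ≠ 0) :
    ∃ T, IsTope f Set.univ T ∧ (∀ e, f e v ≠ 0 → T e = SignType.sign (f e v)) ∧
      ∀ e, f e v = 0 → T e = SignType.sign ((f e).linear w) := by
  have hadd (e : E) (ε : ℝ) : f e (v + ε • w) = f e v + ε * (f e).linear w := by
    have := (f e).map_vadd v (ε • w)
    simpa [add_comm] using this
  have hev : ∀ᶠ ε : ℝ in nhdsWithin 0 (Set.Ioi 0), ∀ e, SignType.sign (f e (v + ε • w)) =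
      if f e v = 0 then SignType.sign ((f e).linear w) else SignType.sign (f e v) := by
    rw [Filter.eventually_all]
    intro e
    by_cases h0 : f e v = 0
    · filter_upwards [self_mem_nhdsWithin] with ε hε
      rw [hadd, if_pos h0, h0, zero_add, sign_mul, sign_pos hε, one_mul]
    · have hc : Filter.Tendsto (fun ε : ℝ => f e v + ε * (f e).linear w)
          (nhdsWithin 0 (Set.Ioi 0)) (nhds (f e v)) := by
        have : Continuous fun ε : ℝ => f e v + ε * (f e).linear w := by fun_prop
        simpa using (this.tendsto 0).mono_left nhdsWithin_le_nhds
      rcases lt_or_gt_of_ne h0 with hlt | hgt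
      · filter_upwards [hc.eventually_lt_const hlt] with ε hε
        rw [hadd, if_neg h0, sign_neg hε, sign_neg hlt]
      · filter_upwards [hc.eventually_const_lt hgt] with ε hε
        rw [hadd, if_neg h0, sign_pos hε, sign_pos hgt]
  obtain ⟨ε, hε⟩ := hev.exists
  refine ⟨fun e => SignType.sign (f e (v + ε • w)),
    isTope_of_forall_ne_zero ⟨v + ε • w, fun _ => rfl, trivial⟩ fun e => ?_,
    fun e h0 => ?_, fun e h0 => ?_⟩
  · rw [hε]
    split_ifs with h0
    · simpa using h e h0
    · simpa using h0
  · exact (hε e).trans (if_neg h0)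
  · exact (hε e).trans (if_pos h0)

theorem IsTope.ne_zero {E V : Type*} [Finite E] [NormedAddCommGroup V] [NormedSpace ℝ V]
    {f : E → (V →ᵃ[ℝ] ℝ)} (hf : ∀ e, (f e).linear ≠ 0) {T : E → SignType}
    (hT : IsTope f Set.univ T) (e : E) : T e ≠ 0 := by
  obtain ⟨⟨x, hx, -⟩, hmax⟩ := hT
  obtain ⟨u, hu⟩ : ∃ u : V, ∀ e, (f e).linear u ≠ 0 :=
    Module.Dual.exists_forall_ne_zero_of_forall_exists (fun e => (f e).linear) fun e => by
      simpa [LinearMap.ext_iff] using hf e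
  obtain ⟨T', hT', h1, h2⟩ := exists_isTope_of_transverse f (v := x) (w := u) fun e _ => hu e
  have hle : sle T T' := by
    funext e
    by_cases h0 : T e = 0
    · simp [scomp, h0]
    · have : f e x ≠ 0 := fun h => h0 (by rw [← hx e, h, sign_zero])
      simp [scomp, h0, h1 e this, hx e]
  rw [← hmax T' hT'.1 hle]
  by_cases h0 : f e x = 0
  · rw [h2 e h0]
    simpa using hu e
  · rw [h1 e h0]
    simpa using h0

section Charts

variable (f : E → (V →ᵃ[ℝ] ℝ))

/-- The linear parts of the `f e`, oriented so as to be positive on the side of `T`. -/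
noncomputable def orientedForm (T : E → SignType) (e : E) : V →L[ℝ] ℝ :=
  (T e : ℝ) • (f e).linear.toContinuousLinearMap

/-- The fibre of `M(A)` over the point of `Z(A)` represented by `(v, T)`. -/
def fibreCone (T : E → SignType) (v : V) : Set V :=
  barrierCone (orientedForm f T) fun e => f e v

/-- The fibre coordinate with values in the dual of `V` attached to the tope `T`. -/
noncomputable def fibreCoord (T : E → SignType) (v w : V) : V →L[ℝ] ℝ :=
  barrierGrad (orientedForm f T) (fun e => f e v) w

omit [Fintype E] in
theorem mem_fibreCone_iff {T : E → SignType} {v w : V} :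
    w ∈ fibreCone f T v ↔ ∀ e, f e v = 0 → 0 < (T e : ℝ) * (f e).linear w := Iff.rfl

omit [Fintype E] in
theorem mem_fibreCone_iff_sign {T : E → SignType} (hT : ∀ e, T e ≠ 0) {v w : V} :
    w ∈ fibreCone f T v ↔ ∀ e, f e v = 0 → SignType.sign ((f e).linear w) = T e := by
  rw [mem_fibreCone_iff]
  refine forall₂_congr fun e _ => ?_
  have h0 := hT e
  rcases h : T e with _ | _ | _
  · exact absurd h h0
  · simp [sign_eq_neg_one_iff]
  · simp [sign_eq_one_iff]

omit [Fintype E] in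
theorem convex_fibreCone (T : E → SignType) (v : V) : Convex ℝ (fibreCone f T v) := by
  intro x hx y hy a b ha hb hab e he
  have h1 := hx e he
  have h2 := hy e he
  rw [map_add, map_smul, map_smul, smul_eq_mul, smul_eq_mul]
  rcases ha.eq_or_lt with rfl | ha
  · obtain rfl : b = 1 := by linarith
    simpa using h2
  · have := mul_pos ha h1
    have := mul_nonneg hb h2.le
    linarith

theorem isOpen_fibreCone (T : E → SignType) :
    IsOpen {p : V × V | p.2 ∈ fibreCone f T p.1} := by
  have : {p : V × V | p.2 ∈ fibreCone f T p.1} =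
      ⋂ e, ({p | f e p.1 ≠ 0} ∪ {p | 0 < orientedForm f T e p.2}) := by
    ext p
    simp only [fibreCone, barrierCone, Set.mem_iInter, Set.mem_union, Set.mem_ofPred_eq,
      imp_iff_not_or, ne_eq]
  rw [this]
  refine isOpen_iInter_of_finite fun e => IsOpen.union ?_ ?_
  · exact isOpen_ne_fun ((f e).continuous_of_finiteDimensional.comp continuous_fst)
      continuous_const
  · exact isOpen_lt continuous_const ((orientedForm f T e).continuous.comp continuous_snd)

theorem fibreCone_nonempty (hf : ∀ e, (f e).linear ≠ 0) {T : E → SignType}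
    (hT : IsTope f Set.univ T) (v : V) : (fibreCone f T v).Nonempty := by
  obtain ⟨x, hx, -⟩ := hT.1
  refine ⟨x - v, (mem_fibreCone_iff_sign f (hT.ne_zero hf)).2 fun e he => ?_⟩
  rw [← hx e, ← vsub_eq_sub, AffineMap.linearMap_vsub, he]
  simp

omit [Fintype E] in
theorem fibreCone_congr {T T' : E → SignType} {v : V} (h : ∀ e, f e v = 0 → T e = T' e) :
    fibreCone f T v = fibreCone f T' v := by
  ext w
  simp only [mem_fibreCone_iff]
  refine forall₂_congr fun e he => ?_
  rw [h e he]

omit [Fintype E] in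
theorem eq_of_mem_fibreCone {T T' : E → SignType} (hT : ∀ e, T e ≠ 0) (hT' : ∀ e, T' e ≠ 0)
    {v w : V} (h : w ∈ fibreCone f T v) (h' : w ∈ fibreCone f T' v) {e : E} (he : f e v = 0) :
    T e = T' e := by
  rw [← (mem_fibreCone_iff_sign f hT).1 h e he, (mem_fibreCone_iff_sign f hT').1 h' e he]

theorem continuousAt_fibreCoord (T : E → SignType) {v w : V} (h : w ∈ fibreCone f T v) :
    ContinuousAt (fun p : V × V => fibreCoord f T p.1 p.2) (v, w) := by
  refine ContinuousAt.add (by fun_prop) (tendsto_finsetSum _ fun e _ => ?_)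
  have h1 : ContinuousAt (fun p : V × V => f e p.1) (v, w) :=
    ((f e).continuous_of_finiteDimensional.comp continuous_fst).continuousAt
  have h2 : ContinuousAt (fun p : V × V => orientedForm f T e p.2) (v, w) := by fun_prop
  exact (continuousAt_logBarrier h1 h2 (h e)).smul continuousAt_const

/-- Two fibre coordinates differ by a translation depending only on the base point. -/
theorem fibreCoord_sub_fibreCoord {T T' : E → SignType} (hT : ∀ e, T e ≠ 0)
    (hT' : ∀ e, T' e ≠ 0) {v : V} (h : ∀ e, f e v = 0 → T e = T' e) (w w' : V) :
    fibreCoord f T v w - fibreCoord f T' v w = fibreCoord f T v w' - fibreCoord f T' v w' := by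
  simp only [fibreCoord, barrierGrad, add_sub_add_left_eq_sub, ← Finset.sum_sub_distrib]
  refine Finset.sum_congr rfl fun e _ => ?_
  by_cases h0 : f e v = 0
  · have : orientedForm f T e = orientedForm f T' e := by simp only [orientedForm, h e h0]
    rw [this, sub_self, sub_self]
  · ext u
    have k := logBarrier_add_neg h0 ((f e).linear w)
    have k' := logBarrier_add_neg h0 ((f e).linear w')
    have h1 := hT e
    have h2 := hT' e
    rcases ht : T e with _ | _ | _ <;> rcases ht' : T' e with _ | _ | _ <;>
      first
      | exact absurd ht h1
      | exact absurd ht' h2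
      | simp [orientedForm, ht, ht']
    · linear_combination (-(f e).linear u) * (k - k')
    · linear_combination (f e).linear u * (k - k')

theorem surjOn_fibreCoord (hf : ∀ e, (f e).linear ≠ 0) {T : E → SignType}
    (hT : IsTope f Set.univ T) (v : V) (ξ : V →L[ℝ] ℝ) :
    ∃ w ∈ fibreCone f T v, fibreCoord f T v w = ξ :=
  surjOn_barrierGrad _ _ (fibreCone_nonempty f hf hT v) (Set.mem_univ ξ)

open Classical in
/-- The point of the fibre cone with a prescribed fibre coordinate. -/
noncomputable def fibrePoint (T : E → SignType) (v : V) (ξ : V →L[ℝ] ℝ) : V :=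
  if h : ∃ w ∈ fibreCone f T v, fibreCoord f T v w = ξ then h.choose else 0

section

variable {f}
variable (hf : ∀ e, (f e).linear ≠ 0)

include hf

theorem fibrePoint_mem {T : E → SignType} (hT : IsTope f Set.univ T) (v : V)
    (ξ : V →L[ℝ] ℝ) : fibrePoint f T v ξ ∈ fibreCone f T v := by
  have h := surjOn_fibreCoord f hf hT v ξ
  rw [fibrePoint, dif_pos h]
  exact h.choose_spec.1

theorem fibreCoord_fibrePoint {T : E → SignType} (hT : IsTope f Set.univ T) (v : V)
    (ξ : V →L[ℝ] ℝ) : fibreCoord f T v (fibrePoint f T v ξ) = ξ := by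
  have h := surjOn_fibreCoord f hf hT v ξ
  rw [fibrePoint, dif_pos h]
  exact h.choose_spec.2

omit hf in
theorem injOn_fibreCoord (T : E → SignType) (v : V) :
    Set.InjOn (fibreCoord f T v) (fibreCone f T v) := by
  intro w hw w' hw' h
  obtain ⟨C, -, hC⟩ := exists_norm_sub_le_barrierGrad V E
  have := hC _ _ w hw w' hw'
  change ‖w - w'‖ ≤ C * ‖fibreCoord f T v w - fibreCoord f T v w'‖ at this
  rw [h, sub_self, norm_zero, mul_zero] at this
  exact sub_eq_zero.1 (norm_le_zero_iff.1 this)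

theorem fibrePoint_fibreCoord {T : E → SignType} (hT : IsTope f Set.univ T) {v w : V}
    (hw : w ∈ fibreCone f T v) : fibrePoint f T v (fibreCoord f T v w) = w :=
  injOn_fibreCoord T v (fibrePoint_mem hf hT _ _) hw (fibreCoord_fibrePoint hf hT _ _)

theorem continuous_fibrePoint {T : E → SignType} (hT : IsTope f Set.univ T) :
    Continuous fun p : V × (V →L[ℝ] ℝ) => fibrePoint f T p.1 p.2 := by
  obtain ⟨C, -, hC⟩ := exists_norm_sub_le_barrierGrad V E
  rw [continuous_iff_continuousAt]
  rintro ⟨v, ξ⟩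
  set w := fibrePoint f T v ξ with hw
  have hmem : w ∈ fibreCone f T v := fibrePoint_mem hf hT v ξ
  have hpair : Continuous fun p : V × (V →L[ℝ] ℝ) => (p.1, w) := by fun_prop
  have hev : ∀ᶠ p : V × (V →L[ℝ] ℝ) in nhds (v, ξ), w ∈ fibreCone f T p.1 :=
    ((isOpen_fibreCone f T).preimage hpair).mem_nhds hmem
  have hcoord : ContinuousAt (fun p : V × (V →L[ℝ] ℝ) => fibreCoord f T p.1 w) (v, ξ) :=
    ContinuousAt.comp (f := fun p : V × (V →L[ℝ] ℝ) => (p.1, w)) (x := (v, ξ))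
      (continuousAt_fibreCoord f T hmem) hpair.continuousAt
  have hlim : Filter.Tendsto
      (fun p : V × (V →L[ℝ] ℝ) => C * ‖p.2 - fibreCoord f T p.1 w‖) (nhds (v, ξ)) (nhds 0) := by
    have := ((continuous_snd.continuousAt (x := (v, ξ))).sub hcoord).norm.const_mul C
    simpa [ContinuousAt, hw, fibreCoord_fibrePoint hf hT] using this
  rw [ContinuousAt, tendsto_iff_norm_sub_tendsto_zero]
  refine squeeze_zero' (Filter.Eventually.of_forall fun _ => norm_nonneg _) ?_ hlim
  filter_upwards [hev] with p hp
  have := hC _ _ _ (fibrePoint_mem hf hT p.1 p.2) _ hp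
  change _ ≤ C * ‖fibreCoord f T p.1 _ - fibreCoord f T p.1 w‖ at this
  rwa [fibreCoord_fibrePoint hf hT] at this

end

/-- The point of `Z(A)` represented by `(v, T)`. -/
def zPoint (v : V) (T : Topes f (Set.univ : Set V)) : ZSpace f (Set.univ : Set V) :=
  Quot.mk _ (⟨v, Set.mem_univ v⟩, T)

/-- The chart domain of `Z(A)` attached to the tope `T`. -/
def zChart (T : Topes f (Set.univ : Set V)) : Set (ZSpace f (Set.univ : Set V)) :=
  Set.range fun v => zPoint f v T

variable {f}

omit [FiniteDimensional ℝ V] [Fintype E] in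
theorem continuous_zPoint (T : Topes f (Set.univ : Set V)) :
    Continuous fun v => zPoint f v T :=
  continuous_quot_mk.comp (by fun_prop)

omit [FiniteDimensional ℝ V] [Fintype E] in
theorem exists_zPoint (z : ZSpace f (Set.univ : Set V)) : ∃ v T, z = zPoint f v T := by
  obtain ⟨⟨⟨v, -⟩, T⟩, rfl⟩ := Quot.exists_rep z
  exact ⟨v, T, rfl⟩

omit [FiniteDimensional ℝ V] [Fintype E] in
theorem continuous_Zproj : Continuous (Zproj f (Set.univ : Set V)) :=
  continuous_quot_lift _ (continuous_subtype_val.comp continuous_fst)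

omit [FiniteDimensional ℝ V] [Fintype E] in
theorem eq_zPoint_of_mem_zChart {T : Topes f (Set.univ : Set V)}
    {z : ZSpace f (Set.univ : Set V)} (hz : z ∈ zChart f T) :
    z = zPoint f (Zproj f _ z) T := by
  obtain ⟨v, rfl⟩ := hz
  rfl

omit [FiniteDimensional ℝ V] [Fintype E] in
theorem forall_mem_sepSet_iff {T T' : E → SignType} (hT : ∀ e, T e ≠ 0)
    (hT' : ∀ e, T' e ≠ 0) (v : V) :
    (∀ e ∈ SepSet T T', f e v ≠ 0) ↔ ∀ e, f e v = 0 → T e = T' e := by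
  have key (a b : SignType) (ha : a ≠ 0) (hb : b ≠ 0) :
      (a = 1 ∧ b = -1) ∨ (a = -1 ∧ b = 1) ↔ a ≠ b := by
    revert a b
    decide
  refine forall_congr' fun e => ?_
  rw [SepSet, Set.mem_ofPred_eq, key _ _ (hT e) (hT' e)]
  tauto

section

variable (hf : ∀ e, (f e).linear ≠ 0)

include hf

omit [FiniteDimensional ℝ V] in
theorem zPoint_eq_zPoint_iff {v v' : V} {T T' : Topes f (Set.univ : Set V)} :
    zPoint f v T = zPoint f v' T' ↔ v = v' ∧ ∀ e, f e v = 0 → T.1 e = T'.1 e := by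
  have hrel (p q : ZPre f (Set.univ : Set V)) : ZRel f Set.univ p q ↔
      (p.1 : V) = q.1 ∧ ∀ e, f e (p.1 : V) = 0 → p.2.1 e = q.2.1 e :=
    and_congr_right fun _ =>
      forall_mem_sepSet_iff (p.2.2.ne_zero hf) (q.2.2.ne_zero hf) (p.1 : V)
  have heq : Equivalence (ZRel f (Set.univ : Set V)) := by
    refine ⟨fun p => ?_, fun {p q} h => ?_, fun {p q r} h h' => ?_⟩
    · rw [hrel]
      exact ⟨rfl, fun _ _ => rfl⟩
    · rw [hrel] at h ⊢
      exact ⟨h.1.symm, fun e he => (h.2 e (by rwa [h.1])).symm⟩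
    · rw [hrel] at h h' ⊢
      exact ⟨h.1.trans h'.1, fun e he => (h.2 e he).trans (h'.2 e (by rwa [← h.1]))⟩
  exact (heq.quot_mk_eq_iff _ _).trans (hrel _ _)

theorem isOpen_zChart (T : Topes f (Set.univ : Set V)) : IsOpen (zChart f T) := by
  have hq : Topology.IsQuotientMap (Quot.mk (ZRel f (Set.univ : Set V))) := isQuotientMap_quot_mk
  refine hq.isOpen_preimage.1 ?_
  have : Quot.mk (ZRel f (Set.univ : Set V)) ⁻¹' zChart f T =
      ⋂ e, ({p | f e (p.1 : V) ≠ 0} ∪ {p | p.2.1 e = T.1 e}) := by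
    ext ⟨⟨v, -⟩, T'⟩
    simp only [Set.mem_iInter, Set.mem_union, Set.mem_ofPred_eq]
    constructor
    · rintro ⟨v', hv'⟩ e
      obtain ⟨rfl, h⟩ := (zPoint_eq_zPoint_iff hf).1 hv'
      by_cases h0 : f e v' = 0
      · exact Or.inr (h e h0).symm
      · exact Or.inl h0
    · intro h
      exact ⟨v, (zPoint_eq_zPoint_iff hf).2
        ⟨rfl, fun e he => ((h e).resolve_left (not_not.2 he)).symm⟩⟩
  rw [this]
  refine isOpen_iInter_of_finite fun e => IsOpen.union ?_ ?_
  · exact isOpen_ne_fun ((f e).continuous_of_finiteDimensional.comp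
      (continuous_subtype_val.comp continuous_fst)) continuous_const
  · exact (isOpen_discrete {T' : Topes f (Set.univ : Set V) | T'.1 e = T.1 e}).preimage
      continuous_snd

omit hf in
theorem exists_tope_mem_fibreCone (p : MSpace f (Set.univ : Set V)) :
    ∃ T : Topes f (Set.univ : Set V), p.1.2 ∈ fibreCone f T.1 p.1.1 := by
  obtain ⟨T, hT, -, h⟩ := exists_isTope_of_transverse f (v := p.1.1) (w := p.1.2)
    fun e he he' => p.2.2 e ⟨he, he'⟩
  refine ⟨⟨T, hT⟩, (mem_fibreCone_iff f).2 fun e he => ?_⟩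
  have h0 : (f e).linear p.1.2 ≠ 0 := fun h => p.2.2 e ⟨he, h⟩
  change 0 < ((T e : SignType) : ℝ) * (f e).linear p.1.2
  rw [h e he, mul_comm]
  simpa using h0

omit hf in
/-- A tope whose chart contains the image of a given point of `M(A)`. -/
noncomputable def adjacentTope (p : MSpace f (Set.univ : Set V)) : Topes f (Set.univ : Set V) :=
  (exists_tope_mem_fibreCone p).choose

omit hf in
theorem mem_fibreCone_adjacentTope (p : MSpace f (Set.univ : Set V)) :
    p.1.2 ∈ fibreCone f (adjacentTope p).1 p.1.1 :=
  (exists_tope_mem_fibreCone p).choose_spec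

omit hf in
/-- The projection from `M(A)` to `Z(A)`. -/
noncomputable def complementToZ (p : MSpace f (Set.univ : Set V)) : ZSpace f (Set.univ : Set V) :=
  zPoint f p.1.1 (adjacentTope p)

theorem complementToZ_eq_zPoint_iff {p : MSpace f (Set.univ : Set V)} {v : V}
    {T : Topes f (Set.univ : Set V)} :
    complementToZ p = zPoint f v T ↔ p.1.1 = v ∧ p.1.2 ∈ fibreCone f T.1 p.1.1 := by
  have hp := mem_fibreCone_adjacentTope p
  rw [complementToZ, zPoint_eq_zPoint_iff hf]
  refine and_congr_right fun _ => ⟨fun h => ?_, fun h e he => ?_⟩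
  · rwa [← fibreCone_congr f h]
  · exact eq_of_mem_fibreCone f ((adjacentTope p).2.ne_zero hf) (T.2.ne_zero hf) hp h he

theorem complementToZ_mem_zChart_iff {p : MSpace f (Set.univ : Set V)} {T : Topes f (Set.univ : Set V)} :
    complementToZ p ∈ zChart f T ↔ p.1.2 ∈ fibreCone f T.1 p.1.1 := by
  constructor
  · rintro ⟨v, hv⟩
    exact ((complementToZ_eq_zPoint_iff hf).1 hv.symm).2
  · intro h
    exact ⟨p.1.1, ((complementToZ_eq_zPoint_iff hf).2 ⟨rfl, h⟩).symm⟩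

omit hf [Fintype E] [FiniteDimensional ℝ V] in
theorem continuous_MSpace_val :
    Continuous fun p : MSpace f (Set.univ : Set V) => (p.1 : V × V) :=
  continuous_subtype_val

theorem continuous_complementToZ : Continuous (complementToZ (f := f)) := by
  rw [continuous_iff_continuousAt]
  intro p
  have hev : ∀ᶠ q : MSpace f (Set.univ : Set V) in nhds p,
      q.1.2 ∈ fibreCone f (adjacentTope p).1 q.1.1 :=
    ((isOpen_fibreCone f _).preimage continuous_MSpace_val).mem_nhds
      (mem_fibreCone_adjacentTope p)
  refine ContinuousAt.congr (f := fun q => zPoint f q.1.1 (adjacentTope p)) ?_ ?_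
  · exact ((continuous_zPoint _).comp
      (continuous_fst.comp continuous_MSpace_val)).continuousAt
  · filter_upwards [hev] with q hq
    exact ((complementToZ_eq_zPoint_iff hf).2 ⟨rfl, hq⟩).symm

/-- The point of `M(A)` with real part `v` and imaginary part `w` in the fibre cone of `T`. -/
def mPoint (T : Topes f (Set.univ : Set V)) (v w : V) (hw : w ∈ fibreCone f T.1 v) :
    MSpace f (Set.univ : Set V) :=
  ⟨(v, w), Set.mem_univ v, fun e he => by
    have := hw e he.1
    simp [orientedForm, he.2] at this⟩

theorem complementToZ_mPoint (T : Topes f (Set.univ : Set V)) (v w : V) (hw : w ∈ fibreCone f T.1 v) :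
    complementToZ (mPoint T v w hw) = zPoint f v T :=
  (complementToZ_eq_zPoint_iff hf).2 ⟨rfl, hw⟩

/-- Translation of a point of `M(A)` by a covector, in fibre coordinates. -/
noncomputable def dualTranslate (ξ : V →L[ℝ] ℝ) (p : MSpace f (Set.univ : Set V)) :
    MSpace f (Set.univ : Set V) :=
  mPoint (adjacentTope p) p.1.1 (fibrePoint f (adjacentTope p).1 p.1.1
    (ξ + fibreCoord f (adjacentTope p).1 p.1.1 p.1.2)) (fibrePoint_mem hf (adjacentTope p).2 _ _)

theorem complementToZ_dualTranslate (ξ : V →L[ℝ] ℝ) (p : MSpace f (Set.univ : Set V)) :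
    complementToZ (dualTranslate hf ξ p) = complementToZ p :=
  complementToZ_mPoint hf _ _ _ _

theorem dualTranslate_val_fst (ξ : V →L[ℝ] ℝ) (p : MSpace f (Set.univ : Set V)) :
    (dualTranslate hf ξ p).1.1 = p.1.1 := rfl

theorem dualTranslate_mem_fibreCone {T : Topes f (Set.univ : Set V)} (ξ : V →L[ℝ] ℝ)
    {p : MSpace f (Set.univ : Set V)} (hp : p.1.2 ∈ fibreCone f T.1 p.1.1) :
    (dualTranslate hf ξ p).1.2 ∈ fibreCone f T.1 p.1.1 :=
  (complementToZ_mem_zChart_iff hf (p := dualTranslate hf ξ p)).1 <| by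
    rwa [complementToZ_dualTranslate, complementToZ_mem_zChart_iff hf]

theorem fibreCoord_dualTranslate {T : Topes f (Set.univ : Set V)} (ξ : V →L[ℝ] ℝ)
    {p : MSpace f (Set.univ : Set V)} (hp : p.1.2 ∈ fibreCone f T.1 p.1.1) :
    fibreCoord f T.1 p.1.1 (dualTranslate hf ξ p).1.2 = ξ + fibreCoord f T.1 p.1.1 p.1.2 := by
  have hT := (adjacentTope p).2.ne_zero hf
  have hT' := T.2.ne_zero hf
  have h := fibreCoord_sub_fibreCoord f hT hT'
    (fun e he => eq_of_mem_fibreCone f hT hT' (mem_fibreCone_adjacentTope p) hp he)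
    (dualTranslate hf ξ p).1.2 p.1.2
  have h' : fibreCoord f (adjacentTope p).1 p.1.1 (dualTranslate hf ξ p).1.2 =
      ξ + fibreCoord f (adjacentTope p).1 p.1.1 p.1.2 :=
    fibreCoord_fibrePoint hf (adjacentTope p).2 _ _
  rw [h'] at h
  rw [← sub_eq_zero] at h ⊢
  rw [← neg_eq_zero, ← h]
  abel

theorem dualTranslate_val_snd {T : Topes f (Set.univ : Set V)} (ξ : V →L[ℝ] ℝ)
    {p : MSpace f (Set.univ : Set V)} (hp : p.1.2 ∈ fibreCone f T.1 p.1.1) :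
    (dualTranslate hf ξ p).1.2 =
      fibrePoint f T.1 p.1.1 (ξ + fibreCoord f T.1 p.1.1 p.1.2) := by
  rw [← fibreCoord_dualTranslate hf ξ hp,
    fibrePoint_fibreCoord hf T.2 (dualTranslate_mem_fibreCone hf ξ hp)]

omit hf in
theorem continuousAt_fibreCoord_MSpace (T : Topes f (Set.univ : Set V))
    {p : MSpace f (Set.univ : Set V)} (hp : p.1.2 ∈ fibreCone f T.1 p.1.1) :
    ContinuousAt (fun q : MSpace f (Set.univ : Set V) => fibreCoord f T.1 q.1.1 q.1.2) p :=
  ContinuousAt.comp (f := fun q : MSpace f (Set.univ : Set V) => q.1)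
    (continuousAt_fibreCoord f T.1 hp) continuous_MSpace_val.continuousAt

theorem continuous_dualTranslate :
    Continuous fun q : (V →L[ℝ] ℝ) × MSpace f (Set.univ : Set V) => dualTranslate hf q.1 q.2 := by
  refine Continuous.subtype_mk (f := fun q : (V →L[ℝ] ℝ) × MSpace f (Set.univ : Set V) =>
    (dualTranslate hf q.1 q.2).1) ?_ _
  rw [continuous_iff_continuousAt]
  rintro ⟨ξ, p⟩
  set T := adjacentTope p
  have hp : p.1.2 ∈ fibreCone f T.1 p.1.1 := mem_fibreCone_adjacentTope p
  have hval : Continuous fun q : (V →L[ℝ] ℝ) × MSpace f (Set.univ : Set V) => q.2.1 :=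
    continuous_MSpace_val.comp continuous_snd
  have hev : ∀ᶠ q : (V →L[ℝ] ℝ) × MSpace f (Set.univ : Set V) in nhds (ξ, p),
      q.2.1.2 ∈ fibreCone f T.1 q.2.1.1 :=
    ((isOpen_fibreCone f _).preimage hval).mem_nhds hp
  refine ContinuousAt.congr (f := fun q => (q.2.1.1,
    fibrePoint f T.1 q.2.1.1 (q.1 + fibreCoord f T.1 q.2.1.1 q.2.1.2))) ?_ ?_
  · have hc : ContinuousAt (fun q : (V →L[ℝ] ℝ) × MSpace f (Set.univ : Set V) =>
        fibreCoord f T.1 q.2.1.1 q.2.1.2) (ξ, p) :=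
      ContinuousAt.comp (f := Prod.snd) (continuousAt_fibreCoord_MSpace T hp)
        continuous_snd.continuousAt
    have hv := (continuous_fst.comp hval).continuousAt (x := (ξ, p))
    refine hv.prodMk ?_
    exact ContinuousAt.comp (f := fun q : (V →L[ℝ] ℝ) × MSpace f (Set.univ : Set V) =>
      (q.2.1.1, q.1 + fibreCoord f T.1 q.2.1.1 q.2.1.2))
      (continuous_fibrePoint hf T.2).continuousAt
      (hv.prodMk (continuous_fst.continuousAt.add hc))
  · filter_upwards [hev] with q hq
    exact Prod.ext rfl (dualTranslate_val_snd hf q.1 hq).symm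

omit hf [Fintype E] [FiniteDimensional ℝ V] in
theorem MSpace_ext {p q : MSpace f (Set.univ : Set V)} (h1 : p.1.1 = q.1.1)
    (h2 : p.1.2 = q.1.2) : p = q :=
  Subtype.ext (Prod.ext h1 h2)

/-- The trivialization of `M(A)` over the chart of `Z(A)` attached to the tope `T`. -/
noncomputable def chartTrivialization (T : Topes f (Set.univ : Set V)) :
    (complementToZ (f := f) ⁻¹' zChart f T) ≃ₜ zChart f T × (V →L[ℝ] ℝ) where
  toFun p := (⟨complementToZ p.1, p.2⟩, fibreCoord f T.1 p.1.1.1 p.1.1.2)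
  invFun q := ⟨mPoint T (Zproj f _ q.1.1) (fibrePoint f T.1 (Zproj f _ q.1.1) q.2)
      (fibrePoint_mem hf T.2 _ _), by
    rw [Set.mem_preimage, complementToZ_mPoint hf]
    exact ⟨_, rfl⟩⟩
  left_inv p := Subtype.ext <| MSpace_ext rfl <|
    fibrePoint_fibreCoord hf T.2 ((complementToZ_mem_zChart_iff hf).1 p.2)
  right_inv q := by
    refine Prod.ext (Subtype.ext ?_) (fibreCoord_fibrePoint hf T.2 _ _)
    exact (complementToZ_mPoint hf _ _ _ (fibrePoint_mem hf T.2 _ _)).trans (eq_zPoint_of_mem_zChart q.1.2).symm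
  continuous_toFun := by
    refine Continuous.prodMk
      (((continuous_complementToZ hf).comp continuous_subtype_val).subtype_mk _) ?_
    rw [continuous_iff_continuousAt]
    intro p
    exact ContinuousAt.comp (f := Subtype.val)
      (continuousAt_fibreCoord_MSpace T ((complementToZ_mem_zChart_iff hf).1 p.2))
      continuous_subtype_val.continuousAt
  continuous_invFun := by
    have hv : Continuous fun q : zChart f T × (V →L[ℝ] ℝ) => Zproj f Set.univ q.1.1 :=
      continuous_Zproj.comp (continuous_subtype_val.comp continuous_fst)
    refine Continuous.subtype_mk (Continuous.subtype_mk (hv.prodMk ?_) _) _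
    exact (continuous_fibrePoint hf T.2).comp (hv.prodMk continuous_snd)

theorem isAddPrincipalBundle_complementToZ :
    IsAddPrincipalBundle (V →L[ℝ] ℝ) (dualTranslate hf) (complementToZ (f := f)) where
  act_zero p := by
    have hp := mem_fibreCone_adjacentTope p
    refine MSpace_ext rfl ?_
    rw [dualTranslate_val_snd hf 0 hp, zero_add, fibrePoint_fibreCoord hf (adjacentTope p).2 hp]
  act_add ξ ξ' p := by
    have hp := mem_fibreCone_adjacentTope p
    have hp' := dualTranslate_mem_fibreCone hf ξ' hp
    refine MSpace_ext rfl ?_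
    rw [dualTranslate_val_snd hf _ hp, dualTranslate_val_snd hf ξ (p := dualTranslate hf ξ' p) hp',
      dualTranslate_val_fst, fibreCoord_dualTranslate hf ξ' hp, add_assoc]
  continuous_act := continuous_dualTranslate hf
  continuous_proj := continuous_complementToZ hf
  proj_act := complementToZ_dualTranslate hf
  locTriv z := by
    obtain ⟨v, T, rfl⟩ := exists_zPoint z
    refine ⟨zChart f T, isOpen_zChart hf T, ⟨v, rfl⟩, chartTrivialization hf T,
      fun _ => rfl, fun ξ p hq => ?_⟩
    exact Prod.ext (Subtype.ext (complementToZ_dualTranslate hf ξ p.1))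
      (fibreCoord_dualTranslate hf ξ ((complementToZ_mem_zChart_iff hf).1 p.2))

/-- The fibre of `M(A)` over a point of `Z(A)`, as a set of imaginary parts. -/
def zFibre (z : ZSpace f (Set.univ : Set V)) : Set V :=
  {w | ∃ p : MSpace f (Set.univ : Set V), p.1.2 = w ∧ complementToZ p = z}

theorem zFibre_zPoint (v : V) (T : Topes f (Set.univ : Set V)) :
    zFibre (zPoint f v T) = fibreCone f T.1 v := by
  ext w
  constructor
  · rintro ⟨p, rfl, hp⟩
    obtain ⟨rfl, h⟩ := (complementToZ_eq_zPoint_iff hf).1 hp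
    exact h
  · intro h
    exact ⟨mPoint T v w h, rfl, complementToZ_mPoint hf T v w h⟩

theorem convex_zFibre (z : ZSpace f (Set.univ : Set V)) : Convex ℝ (zFibre z) := by
  obtain ⟨v, T, rfl⟩ := exists_zPoint z
  rw [zFibre_zPoint hf]
  exact convex_fibreCone f T.1 v

theorem zFibre_nonempty (z : ZSpace f (Set.univ : Set V)) : (zFibre z).Nonempty := by
  obtain ⟨v, T, rfl⟩ := exists_zPoint z
  rw [zFibre_zPoint hf]
  exact fibreCone_nonempty f hf T.2 v

theorem surjective_complementToZ : Function.Surjective (complementToZ (f := f)) := fun z =>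
  let ⟨_, p, _, hp⟩ := zFibre_nonempty hf z
  ⟨p, hp⟩

theorem complementToZ_eq_iff {p : MSpace f (Set.univ : Set V)}
    {z : ZSpace f (Set.univ : Set V)} :
    complementToZ p = z ↔ p.1.1 = Zproj f _ z ∧ p.1.2 ∈ zFibre z := by
  obtain ⟨v, T, rfl⟩ := exists_zPoint z
  rw [complementToZ_eq_zPoint_iff hf, zFibre_zPoint hf]
  refine and_congr_right fun h => ?_
  have h : p.1.1 = v := h
  rw [h]

theorem isOpen_setOf_mem_zFibre {X : Type*} [TopologicalSpace X]
    (g : C(X, ZSpace f (Set.univ : Set V))) (W : C(X, V)) :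
    IsOpen {x | W x ∈ zFibre (g x)} := by
  have key : {x | W x ∈ zFibre (g x)} = ⋃ T : Topes f (Set.univ : Set V),
      g ⁻¹' zChart f T ∩ {x | W x ∈ fibreCone f T.1 (Zproj f _ (g x))} := by
    ext x
    simp only [Set.mem_iUnion, Set.mem_inter_iff, Set.mem_preimage, Set.mem_ofPred_eq]
    constructor
    · intro h
      obtain ⟨v, T, hT⟩ := exists_zPoint (g x)
      refine ⟨T, ⟨v, hT.symm⟩, ?_⟩
      rw [hT, zFibre_zPoint hf] at h
      rwa [hT]
    · rintro ⟨T, hT, h⟩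
      rwa [eq_zPoint_of_mem_zChart hT, zFibre_zPoint hf]
  rw [key]
  refine isOpen_iUnion fun T => ((isOpen_zChart hf T).preimage g.continuous).inter ?_
  exact (isOpen_fibreCone f T.1).preimage
    ((continuous_Zproj.comp g.continuous).prodMk W.continuous)

/-- The projection `M(A) → Z(A)` has the relative lifting property with respect to closed
subsets of compact Hausdorff spaces. -/
theorem exists_lift_complementToZ {X : Type*} [TopologicalSpace X] [CompactSpace X] [T2Space X]
    (g : C(X, ZSpace f (Set.univ : Set V))) {A : Set X} (hA : IsClosed A)
    (s : X → MSpace f (Set.univ : Set V)) (hs : ContinuousOn s A)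
    (hsg : ∀ a ∈ A, complementToZ (s a) = g a) :
    ∃ S : C(X, MSpace f (Set.univ : Set V)), (∀ x, complementToZ (S x) = g x) ∧
      ∀ a ∈ A, S a = s a := by
  obtain ⟨W, hW⟩ : ∃ W : C(X, V), ∀ a ∈ A, W a = (s a).1.2 := by
    have hc : Continuous fun a : A => (s a).1.2 :=
      continuous_snd.comp (continuous_MSpace_val.comp hs.domRestrict)
    obtain ⟨W, hW⟩ := ContinuousMap.exists_restrict_eq hA (⟨_, hc⟩ : C(A, V))
    exact ⟨W, fun a ha => DFunLike.congr_fun hW ⟨a, ha⟩⟩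
  obtain ⟨w, hw⟩ : ∃ w : C(X, V), ∀ x, w x ∈ {u | u ∈ zFibre (g x) ∧ (x ∈ A → u = W x)} := by
    refine exists_continuous_forall_mem_convex_of_local (fun x => ?_) fun x => ?_
    · intro u hu u' hu' a b ha hb hab
      refine ⟨convex_zFibre hf (g x) hu.1 hu'.1 ha hb hab, fun hx => ?_⟩
      rw [hu.2 hx, hu'.2 hx, ← add_smul, hab, one_smul]
    · by_cases hx : x ∈ A
      · refine ⟨_, (isOpen_setOf_mem_zFibre hf g W).mem_nhds ?_, W, W.continuous.continuousOn,
          fun y hy => ⟨hy, fun _ => rfl⟩⟩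
        exact ⟨s x, (hW x hx).symm, hsg x hx⟩
      · obtain ⟨u, hu⟩ := zFibre_nonempty hf (g x)
        exact ⟨_, Filter.inter_mem (hA.isOpen_compl.mem_nhds hx)
          ((isOpen_setOf_mem_zFibre hf g (.const X u)).mem_nhds hu), fun _ => u,
          continuousOn_const, fun y hy => ⟨hy.2, fun hyA => (hy.1 hyA).elim⟩⟩
  have hmem (x : X) : ∃ p : MSpace f (Set.univ : Set V),
      p.1 = (Zproj f _ (g x), w x) ∧ complementToZ p = g x := by
    obtain ⟨p, hp, hpg⟩ := (hw x).1
    exact ⟨p, Prod.ext ((complementToZ_eq_iff hf).1 hpg).1 hp, hpg⟩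
  choose S hS hSg using hmem
  have hSc : Continuous fun x => (S x).1 := by
    simp only [hS]
    exact (continuous_Zproj.comp g.continuous).prodMk w.continuous
  refine ⟨⟨S, hSc.subtype_mk _⟩, hSg, fun a ha => MSpace_ext ?_ ?_⟩
  · exact ((complementToZ_eq_iff hf).1 (hSg a)).1.trans
      ((complementToZ_eq_iff hf).1 (hsg a ha)).1.symm
  · exact (congrArg Prod.snd (hS a)).trans (((hw a).2 ha).trans (hW a ha))

end

end Charts

theorem Cube.isClosed_boundary (N : Type*) [Finite N] : IsClosed (Cube.boundary N) := by
  have : Cube.boundary N = ⋃ i, {y | y i = 0 ∨ y i = 1} := by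
    ext y
    simp [Cube.boundary]
  rw [this]
  exact isClosed_iUnion_of_finite fun i =>
    (isClosed_eq (continuous_apply i) continuous_const).union
      (isClosed_eq (continuous_apply i) continuous_const)

/-- A surjection with the relative lifting property with respect to closed subsets of compact
Hausdorff spaces is a weak homotopy equivalence. -/
theorem isWeakHomotopyEquiv_of_exists_lift {P B : Type*} [TopologicalSpace P]
    [TopologicalSpace B] (φ : C(P, B)) (hφ : Function.Surjective φ)
    (hlift : ∀ (X : Type) [TopologicalSpace X] [CompactSpace X] [T2Space X] (g : C(X, B))
      (A : Set X), IsClosed A → ∀ s : X → P, ContinuousOn s A → (∀ a ∈ A, φ (s a) = g a) →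
        ∃ S : C(X, P), (∀ x, φ (S x) = g x) ∧ ∀ a ∈ A, S a = s a) :
    IsWeakHomotopyEquiv φ := by
  refine ⟨⟨?_, ?_⟩, fun n x => ⟨?_, ?_⟩⟩
  · rintro ⟨p⟩ ⟨q⟩ h
    obtain ⟨γ⟩ : Joined (φ p) (φ q) := Quotient.exact h
    have hA : IsClosed ({0, 1} : Set unitInterval) := (Set.toFinite _).isClosed
    obtain ⟨S, -, hS⟩ := hlift unitInterval γ.toContinuousMap {0, 1} hA
      (fun t => if t = 0 then p else q) ((Set.toFinite _).continuousOn _) (by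
        rintro t (rfl | rfl) <;> simp)
    exact Quotient.sound ⟨⟨S, by simpa using hS 0 (by simp), by simpa using hS 1 (by simp)⟩⟩
  · rintro ⟨b⟩
    obtain ⟨p, rfl⟩ := hφ b
    exact ⟨Quotient.mk _ p, rfl⟩
  · rintro ⟨p⟩ ⟨q⟩ h
    obtain ⟨H⟩ := Quotient.exact h
    let s : unitInterval × (Fin n → unitInterval) → P := fun y =>
      if y.1 = 0 then p.1 y.2 else q.1 y.2
    let A₀ : Set (unitInterval × (Fin n → unitInterval)) := {y | y.1 = 0}
    let A₁ : Set (unitInterval × (Fin n → unitInterval)) := {y | y.1 = 1}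
    let A₂ : Set (unitInterval × (Fin n → unitInterval)) := {y | y.2 ∈ Cube.boundary (Fin n)}
    have h₀ : IsClosed A₀ := isClosed_eq continuous_fst continuous_const
    have h₁ : IsClosed A₁ := isClosed_eq continuous_fst continuous_const
    have h₂ : IsClosed A₂ := (Cube.isClosed_boundary (Fin n)).preimage continuous_snd
    have e₀ : Set.EqOn s (fun y => p.1 y.2) A₀ := fun y hy => if_pos hy
    have e₁ : Set.EqOn s (fun y => q.1 y.2) A₁ := fun y hy => if_neg (by
      have hy : y.1 = 1 := hy
      simp [hy])
    have e₂ : Set.EqOn s (fun _ => x) A₂ := fun y hy => by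
      simp only [s, p.2 y.2 hy, q.2 y.2 hy, ite_self]
    have c₀ : ContinuousOn s A₀ :=
      (p.1.continuous.comp continuous_snd).continuousOn.congr e₀
    have c₁ : ContinuousOn s A₁ :=
      (q.1.continuous.comp continuous_snd).continuousOn.congr e₁
    have c₂ : ContinuousOn s A₂ := continuousOn_const.congr e₂
    obtain ⟨S, -, hS⟩ := hlift _ H.toContinuousMap (A₀ ∪ A₁ ∪ A₂) ((h₀.union h₁).union h₂) s
      ((c₀.union_of_isClosed c₁ h₀ h₁).union_of_isClosed c₂ (h₀.union h₁) h₂) (by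
        rintro y ((hy | hy) | hy)
        · rw [e₀ hy]
          obtain ⟨t, y⟩ := y
          obtain rfl : t = 0 := hy
          exact (H.apply_zero y).symm
        · rw [e₁ hy]
          obtain ⟨t, y⟩ := y
          obtain rfl : t = 1 := hy
          exact (H.apply_one y).symm
        · rw [e₂ hy]
          have := H.eq_fst y.1 hy
          exact (congrArg φ (p.2 y.2 hy)).symm.trans this.symm)
    refine Quotient.sound ⟨⟨⟨S, fun y => ?_, fun y => ?_⟩, fun t y hy => ?_⟩⟩
    · exact (hS (0, y) (.inl (.inl rfl))).trans (e₀ (x := (0, y)) rfl)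
    · exact (hS (1, y) (.inl (.inr rfl))).trans (e₁ (x := (1, y)) rfl)
    · exact ((hS (t, y) (.inr hy)).trans (e₂ (x := (t, y)) hy)).trans (p.2 y hy).symm
  · rintro ⟨p⟩
    obtain ⟨S, hSg, hS⟩ := hlift _ p.1 (Cube.boundary (Fin n)) (Cube.isClosed_boundary _)
      (fun _ => x) continuousOn_const fun y hy => (p.2 y hy).symm
    refine ⟨Quotient.mk _ ⟨S, hS⟩, congrArg (Quotient.mk _) (Subtype.ext (ContinuousMap.ext hSg))⟩

/-- The complexified complement `M(A)` is the total space of a principal bundle over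
`Z(A)` with structure group the linear dual `V* = V →L[ℝ] ℝ`.  In particular `M(A)` is
weakly homotopy equivalent to `Z(A)`. -/
theorem complement_principal_bundle_over_Z
    (f : E → (V →ᵃ[ℝ] ℝ)) (hf : ∀ e, (f e).linear ≠ 0) :
    ∃ (act : (V →L[ℝ] ℝ) → MSpace f (Set.univ : Set V) → MSpace f (Set.univ : Set V))
      (φ : C(MSpace f (Set.univ : Set V), ZSpace f (Set.univ : Set V))),
      IsAddPrincipalBundle (V →L[ℝ] ℝ) act ⇑φ ∧ IsWeakHomotopyEquiv φ := by
  exact ⟨dualTranslate hf, ⟨complementToZ, continuous_complementToZ hf⟩,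
    isAddPrincipalBundle_complementToZ hf,
    isWeakHomotopyEquiv_of_exists_lift _ (surjective_complementToZ hf)
      fun _ _ _ _ g _ hA s hs h => exists_lift_complementToZ hf g hA s hs h⟩
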